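/- arXiv:0902.0333 — 2 statements merged into one kernel-verified Lean document; each statement's English description precedes it below -/
import Mathlib

section
/- Let 0 < p < 1 and 2 ≤ d < n/2, and let Λ be the d×d lower-triangular matrix with entries Λ_{ii} = (d + i − 2)/n for 1 ≤ i ≤ d and Λ_{ij} = −(2/n) p^{(i−j)/2} for 1 ≤ j < i ≤ d. Then Λ is invertible and ‖Λ^{−1}‖_{op} ≤ (n/(d−1)) (1 + 2√p/(d−1))^{d−1} ≤ n e^{2√p}/(d−1) ≤ 15 n / d, where ‖·‖_{op} denotes the matrix operator norm on ℝ^d. -/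
open Real

/-- The operator norm of a `d × d` real matrix, acting on Euclidean space. -/
noncomputable def matOpNorm {d : ℕ} (A : Matrix (Fin d) (Fin d) ℝ) : ℝ :=
  ‖LinearMap.toContinuousLinearMap (Matrix.toEuclideanLin A)‖

/-- The lower-triangular matrix `Λ` from the runs-on-the-line example: the entry at
`(i, j) : Fin d × Fin d` corresponds to row `i+1` and column `j+1` in `{1, …, d}`, with
`Λ_{ii} = (d+i−2)/n` on the diagonal and `Λ_{ij} = −(2/n) p^{(i−j)/2}` below it. -/
noncomputable def runsLambda (n d : ℕ) (p : ℝ) : Matrix (Fin d) (Fin d) ℝ :=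
  fun i j =>
    if i = j then ((d : ℝ) + (i.val + 1) - 2) / n
    else if j < i then -(2 / n) * Real.sqrt p ^ (i.val - j.val)
    else 0

/-- Schur's test: row and column sums of absolute values bound the `ℓ²` operator norm. -/
theorem matOpNorm_le_of_row_col_sums {d : ℕ} (A : Matrix (Fin d) (Fin d) ℝ) {C : ℝ} (hC : 0 ≤ C)
    (hrow : ∀ i, ∑ j, |A i j| ≤ C) (hcol : ∀ j, ∑ i, |A i j| ≤ C) : matOpNorm A ≤ C := by
  refine ContinuousLinearMap.opNorm_le_bound _ hC fun v => ?_
  rw [← sq_le_sq₀ (norm_nonneg _) (by positivity), mul_pow, EuclideanSpace.real_norm_sq_eq,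
    EuclideanSpace.real_norm_sq_eq]
  have hcoord (i : Fin d) :
      (LinearMap.toContinuousLinearMap (Matrix.toEuclideanLin A) v) i = ∑ j, A i j * v j := rfl
  simp only [hcoord]
  have hcs (i : Fin d) : (∑ j, A i j * v j) ^ 2 ≤ C * ∑ j, |A i j| * v j ^ 2 := by
    refine (Finset.sum_sq_le_sum_mul_sum_of_sq_le_mul Finset.univ (f := fun j => |A i j|)
      (g := fun j => |A i j| * v j ^ 2) (fun _ _ => abs_nonneg _)
      (fun _ _ => by positivity) fun j _ => ?_).trans ?_
    · rw [mul_pow, ← sq_abs (A i j)]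
      exact le_of_eq (by ring)
    · exact mul_le_mul_of_nonneg_right (hrow i) (Finset.sum_nonneg fun _ _ => by positivity)
  calc ∑ i, (∑ j, A i j * v j) ^ 2
      ≤ ∑ i, C * ∑ j, |A i j| * v j ^ 2 := Finset.sum_le_sum fun i _ => hcs i
    _ = C * ∑ j, (∑ i, |A i j|) * v j ^ 2 := by
        rw [← Finset.mul_sum, Finset.sum_comm]
        simp only [Finset.sum_mul]
    _ ≤ C * ∑ j, C * v j ^ 2 := by
        gcongr with j
        exact hcol j
    _ = C ^ 2 * ∑ j, v j ^ 2 := by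
        rw [← Finset.mul_sum]
        ring

/-- A matrix dominated entrywise by a lower-triangular Toeplitz matrix with symbol `c` has
operator norm at most the sum of the coefficients of `c`. -/
theorem matOpNorm_le_sum_of_abs_le_toeplitz {d : ℕ} (A : Matrix (Fin d) (Fin d) ℝ) (c : ℕ → ℝ)
    (hc : ∀ k, 0 ≤ c k)
    (hA : ∀ i j : Fin d, |A i j| ≤ if j ≤ i then c (i.val - j.val) else 0) :
    matOpNorm A ≤ ∑ k ∈ Finset.range d, c k := by
  have key (s : Finset (Fin d)) (φ : Fin d → ℕ) (hφ : Set.InjOn φ s) (hlt : ∀ i ∈ s, φ i < d) :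
      ∑ i ∈ s, c (φ i) ≤ ∑ k ∈ Finset.range d, c k := by
    rw [← Finset.sum_image (f := c) hφ]
    refine Finset.sum_le_sum_of_subset_of_nonneg (fun k hk => ?_) fun k _ _ => hc k
    obtain ⟨i, hi, rfl⟩ := Finset.mem_image.1 hk
    exact Finset.mem_range.2 (hlt i hi)
  refine matOpNorm_le_of_row_col_sums A (Finset.sum_nonneg fun k _ => hc k) (fun i => ?_)
    fun j => ?_
  · refine (Finset.sum_le_sum fun j _ => hA i j).trans ?_
    rw [← Finset.sum_filter]
    refine key _ (fun j => i.val - j.val) (fun a ha b hb hab => ?_) fun a _ => by omega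
    simp only [Finset.coe_filter, Finset.mem_univ, true_and, Set.mem_ofPred_eq, Fin.le_def] at ha hb
    simp only at hab
    omega
  · refine (Finset.sum_le_sum fun i _ => hA i j).trans ?_
    rw [← Finset.sum_filter]
    refine key _ (fun i => i.val - j.val) (fun a ha b hb hab => ?_) fun a _ => by omega
    simp only [Finset.coe_filter, Finset.mem_univ, true_and, Set.mem_ofPred_eq, Fin.le_def] at ha hb
    simp only at hab
    omega

/-- The entries of `n⁻¹ • Λ⁻¹`, with `m = d - 1` and `q = √p`. -/
noncomputable def runsInvEntry (m q : ℝ) (i j : ℕ) : ℝ :=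
  if i = j then 1 / (m + j)
  else if j < i then
    2 * q ^ (i - j) * (m + 1 + i) / ((m + j) * (m + 1 + j) * (m + 2 + j))
  else 0

theorem sum_range_pow_mul_runsInvEntry {m : ℝ} (hm : 0 < m) (q : ℝ) (k i : ℕ) :
    ∑ j ∈ Finset.range i, q ^ (i - j) * runsInvEntry m q j k =
      if k < i then q ^ (i - k) * (m + i) * (m + 1 + i) / ((m + k) * (m + 1 + k) * (m + 2 + k))
      else 0 := by
  induction i with
  | zero => simp
  | succ i ih =>
    have hstep : ∑ j ∈ Finset.range i, q ^ (i + 1 - j) * runsInvEntry m q j k =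
        q * ∑ j ∈ Finset.range i, q ^ (i - j) * runsInvEntry m q j k := by
      rw [Finset.mul_sum]
      refine Finset.sum_congr rfl fun j hj => ?_
      rw [Nat.succ_sub (Finset.mem_range.1 hj).le, pow_succ]
      ring
    rw [Finset.sum_range_succ, hstep, ih, runsInvEntry]
    rcases lt_trichotomy i k with h | rfl | h
    · simp [h.ne, h.not_gt, show ¬ k < i + 1 by omega]
    · have h0 : m + (i : ℝ) ≠ 0 := by positivity
      have h1 : m + 1 + (i : ℝ) ≠ 0 := by positivity
      have h2 : m + 2 + (i : ℝ) ≠ 0 := by positivity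
      simp only [lt_irrefl, if_false, if_true, Nat.lt_succ_self, Nat.add_sub_cancel_left,
        pow_one, Nat.cast_add, Nat.cast_one]
      field_simp
      ring
    · have h0 : m + (k : ℝ) ≠ 0 := by positivity
      have h1 : m + 1 + (k : ℝ) ≠ 0 := by positivity
      have h2 : m + 2 + (k : ℝ) ≠ 0 := by positivity
      rw [if_pos h, if_neg h.ne', if_pos h, if_pos (by omega), Nat.succ_sub h.le,
        Nat.add_sub_cancel_left, pow_one, pow_succ q (i - k)]
      push_cast
      field_simp
      ring

theorem runsLambda_mul_inverse {n d : ℕ} (hn : n ≠ 0) (hd : 2 ≤ d) (p : ℝ) :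
    runsLambda n d p *
      Matrix.of (fun i j : Fin d => (n : ℝ) * runsInvEntry (d - 1) √p i j) = 1 := by
  have hn' : (n : ℝ) ≠ 0 := Nat.cast_ne_zero.2 hn
  have hm : (0 : ℝ) < d - 1 := by
    have : (2 : ℝ) ≤ d := by exact_mod_cast hd
    linarith
  ext i k
  set x : ℕ → ℝ := fun j => runsInvEntry (d - 1) √p j k with hx
  have hsum : ∑ j : Fin d, runsLambda n d p i j * ((n : ℝ) * x j) =
      (d - 1 + i) * x i - 2 * ∑ j ∈ Finset.range i, √p ^ (i.val - j) * x j := by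
    let F : ℕ → ℝ := fun j =>
      (if i.val = j then ((d : ℝ) + (i.val + 1) - 2) / n
        else if j < i.val then -(2 / n) * √p ^ (i.val - j) else 0) * ((n : ℝ) * x j)
    have hF : ∀ j : Fin d, runsLambda n d p i j * ((n : ℝ) * x j) = F j := fun j => by
      simp only [runsLambda, F, Fin.ext_iff, Fin.lt_def]
    rw [Finset.sum_congr rfl fun j _ => hF j, Fin.sum_univ_eq_sum_range F,
      ← Finset.sum_subset (Finset.range_mono i.isLt) (fun j _ hj => ?_),
      Finset.sum_range_succ, Finset.mul_sum, sub_eq_add_neg, add_comm, ← Finset.sum_neg_distrib]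
    · congr 1
      · simp only [F, if_true]
        field_simp
        ring
      · refine Finset.sum_congr rfl fun j hj => ?_
        have hj := Finset.mem_range.1 hj
        simp only [F, if_neg hj.ne', if_pos hj]
        field_simp
    · have hj : i.val < j := by simpa [Nat.lt_succ_iff] using hj
      simp only [F, if_neg hj.ne, if_neg hj.not_gt, zero_mul]
  rw [Matrix.mul_apply]
  refine hsum.trans ?_
  rw [hx, sum_range_pow_mul_runsInvEntry hm, Matrix.one_apply]
  simp only [runsInvEntry, Fin.ext_iff]
  have h0 : (d : ℝ) - 1 + (k : ℕ) ≠ 0 := by positivity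
  rcases lt_trichotomy i.val k.val with h | h | h
  · simp [h.ne, h.not_gt]
  · simp [h, h0]
  · rw [if_neg h.ne', if_pos h, if_pos h, if_neg h.ne']
    ring

/-- Coefficients of the Toeplitz symbol dominating `Λ⁻¹`. -/
noncomputable def geomCoeff (b : ℝ) : ℕ → ℝ
  | 0 => 1
  | k + 1 => b * (1 + b) ^ k

theorem geomCoeff_nonneg {b : ℝ} (hb : 0 ≤ b) : ∀ k, 0 ≤ geomCoeff b k
  | 0 => zero_le_one
  | k + 1 => by
    rw [geomCoeff]
    positivity

theorem sum_range_succ_geomCoeff (b : ℝ) (m : ℕ) :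
    ∑ k ∈ Finset.range (m + 1), geomCoeff b k = (1 + b) ^ m := by
  induction m with
  | zero => simp [geomCoeff]
  | succ m ih =>
    rw [Finset.sum_range_succ, ih, geomCoeff]
    ring

theorem runsInvEntry_nonneg {m q : ℝ} (hm : 0 < m) (hq : 0 ≤ q) (i j : ℕ) :
    0 ≤ runsInvEntry m q i j := by
  unfold runsInvEntry
  split_ifs <;> positivity

theorem runsInvEntry_le {m q : ℝ} (hm : 0 < m) (hq0 : 0 ≤ q) (hq1 : q ≤ 1) (i j : ℕ) :
    runsInvEntry m q i j ≤ if j ≤ i then 1 / m * geomCoeff (2 * q / m) (i - j) else 0 := by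
  rcases lt_trichotomy i j with h | rfl | h
  · simp [runsInvEntry, h.ne, h.not_gt, h.not_ge]
  · simp only [runsInvEntry, le_refl, if_true, Nat.sub_self, geomCoeff, mul_one]
    gcongr
    linarith [Nat.cast_nonneg (α := ℝ) i]
  · obtain ⟨k, rfl⟩ : ∃ k, i = j + k + 1 := ⟨i - j - 1, by omega⟩
    rw [runsInvEntry, if_neg h.ne', if_pos h, if_pos h.le, show j + k + 1 - j = k + 1 by omega,
      geomCoeff]
    have hj : (0 : ℝ) ≤ j := Nat.cast_nonneg j
    have hk : (0 : ℝ) ≤ k := Nat.cast_nonneg k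
    have hrat : (m + 2 + j + k) / ((m + j) * (m + 1 + j) * (m + 2 + j)) ≤
        1 / m ^ 2 * (1 + 2 / m) ^ k := by
      have hB : 1 + k * (2 / m) ≤ (1 + 2 / m) ^ k :=
        one_add_mul_le_pow (le_trans (by norm_num) (div_pos two_pos hm).le) k
      calc (m + 2 + j + k) / ((m + j) * (m + 1 + j) * (m + 2 + j))
          = 1 / ((m + j) * (m + 1 + j)) * (1 + k * (1 / (m + 2 + j))) := by
            field_simp
        _ ≤ 1 / m ^ 2 * (1 + k * (2 / m)) := by
            gcongr ?_ * (1 + k * ?_)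
            · gcongr
              nlinarith
            · gcongr <;> linarith
        _ ≤ _ := by gcongr
    have hpow : q ^ k * (1 + 2 / m) ^ k ≤ (1 + 2 * q / m) ^ k := by
      rw [← mul_pow]
      refine pow_le_pow_left₀ (by positivity) ?_ k
      calc q * (1 + 2 / m) = q + 2 * q / m := by ring
        _ ≤ 1 + 2 * q / m := by gcongr
    calc 2 * q ^ (k + 1) * (m + 1 + ((j + k + 1 : ℕ) : ℝ)) /
          ((m + j) * (m + 1 + j) * (m + 2 + j))
        = 2 * q * q ^ k * ((m + 2 + j + k) / ((m + j) * (m + 1 + j) * (m + 2 + j))) := by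
          push_cast
          ring
      _ ≤ 2 * q * q ^ k * (1 / m ^ 2 * (1 + 2 / m) ^ k) := by gcongr
      _ = 2 * q / m ^ 2 * (q ^ k * (1 + 2 / m) ^ k) := by ring
      _ ≤ 2 * q / m ^ 2 * (1 + 2 * q / m) ^ k := by gcongr
      _ = 1 / m * (2 * q / m * (1 + 2 * q / m) ^ k) := by ring

/-- `Λ` is invertible, with
`‖Λ⁻¹‖_op ≤ (n/(d−1))(1 + 2√p/(d−1))^{d−1} ≤ n e^{2√p}/(d−1) ≤ 15 n/d`. -/
theorem runs_lambda_inverse_op_norm_bound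
    (n d : ℕ) (hd : 2 ≤ d) (hdn : 2 * d < n)
    (p : ℝ) (hp0 : 0 < p) (hp1 : p < 1) :
    IsUnit (runsLambda n d p).det ∧
    matOpNorm (runsLambda n d p)⁻¹
      ≤ ((n : ℝ) / (d - 1)) * (1 + 2 * Real.sqrt p / (d - 1)) ^ (d - 1) ∧
    ((n : ℝ) / (d - 1)) * (1 + 2 * Real.sqrt p / (d - 1)) ^ (d - 1)
      ≤ (n : ℝ) * Real.exp (2 * Real.sqrt p) / (d - 1) ∧
    (n : ℝ) * Real.exp (2 * Real.sqrt p) / (d - 1) ≤ 15 * n / d := by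
  have hd2 : (2 : ℝ) ≤ d := by exact_mod_cast hd
  have hm : (0 : ℝ) < d - 1 := by linarith
  have hq0 : 0 ≤ √p := Real.sqrt_nonneg p
  have hq1 : √p ≤ 1 := Real.sqrt_le_one.2 hp1.le
  have hmul := runsLambda_mul_inverse (n := n) (by omega) hd p
  refine ⟨Matrix.isUnit_det_of_right_inverse hmul, ?_, ?_, ?_⟩
  · rw [Matrix.inv_eq_right_inv hmul]
    have hb : 0 ≤ 2 * √p / ((d : ℝ) - 1) := by positivity
    refine (matOpNorm_le_sum_of_abs_le_toeplitz _
      (fun k => (n : ℝ) / (d - 1) * geomCoeff (2 * √p / (d - 1)) k)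
      (fun k => mul_nonneg (by positivity) (geomCoeff_nonneg hb k)) fun i j => ?_).trans_eq ?_
    · rw [Matrix.of_apply,
        abs_of_nonneg (mul_nonneg n.cast_nonneg (runsInvEntry_nonneg hm hq0 _ _))]
      refine (mul_le_mul_of_nonneg_left (runsInvEntry_le hm hq0 hq1 i j) n.cast_nonneg).trans_eq ?_
      simp only [Fin.le_def, mul_ite, mul_zero]
      congr 1
      ring
    · obtain ⟨m, rfl⟩ : ∃ m, d = m + 1 := ⟨d - 1, by omega⟩
      rw [← Finset.mul_sum, sum_range_succ_geomCoeff, Nat.add_sub_cancel]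
  · rw [mul_div_right_comm (n : ℝ)]
    gcongr
    have hexp : 1 + 2 * √p / ((d : ℝ) - 1) ≤ Real.exp (2 * √p / (d - 1)) := by
      linarith [Real.add_one_le_exp (2 * √p / ((d : ℝ) - 1))]
    refine (pow_le_pow_left₀ (by positivity) hexp _).trans_eq ?_
    rw [← Real.exp_nat_mul, Nat.cast_sub (by omega), Nat.cast_one, mul_div_cancel₀ _ hm.ne']
  · have hexp : Real.exp (2 * √p) ≤ 7.5 := by
      have h2 : Real.exp (2 * √p) ≤ Real.exp 1 ^ 2 := by
        rw [← Real.exp_nat_mul]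
        gcongr
        push_cast
        linarith
      nlinarith [Real.exp_one_lt_d9, Real.exp_pos 1]
    rw [div_le_div_iff₀ hm (by linarith)]
    have hn : (0 : ℝ) ≤ n := n.cast_nonneg
    calc (n : ℝ) * Real.exp (2 * √p) * d ≤ n * 7.5 * d := by gcongr
      _ ≤ 15 * n * (d - 1) := by nlinarith
end

section
/- Let B be a symmetric positive-definite n×n real matrix defining ⟨x,y⟩_B = ⟨Bx, y⟩. Let 𝒱_r be a finite set of vectors v ∈ ℝ^n such that Bv has integer entries, with v + w ≠ 0 for all v, w ∈ 𝒱_r, let (a_v)_{v∈𝒱_r} be uniform on the sphere of radius √2 in ℝ^{|𝒱_r|}, and define f_r(x) = Re( Σ_{v∈𝒱_r} a_v e^{2πi⟨Bv, x⟩} ) on 𝕋^n = ℝ^n/ℤ^n, with ∇_B f_r(x) = −Im( Σ_{v∈𝒱_r} 2π a_v e^{2πi⟨Bv,x⟩} v ). Let X be uniform on 𝕋^n independent of the coefficients. Then E_X E_a [ ‖∇_B f_r(X)‖_B⁴ ] = (8π⁴ / (|𝒱_r|(|𝒱_r|+2))) [ 3 Σ_{v∈𝒱_r} ‖v‖_B⁴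 + 2 (Σ_{v∈𝒱_r} ‖v‖_B²)² + 4 Σ_{v,w∈𝒱_r} ⟨v,w⟩_B² ]. -/
open MeasureTheory ProbabilityTheory Real Matrix

/-- The inner product `⟨x, y⟩_B = ⟨Bx, y⟩` induced by a positive-definite matrix `B`. -/
def bInner {n : ℕ} (B : Matrix (Fin n) (Fin n) ℝ) (x y : Fin n → ℝ) : ℝ :=
  (B.mulVec x) ⬝ᵥ y

/-- The uniform (normalized Hausdorff) probability measure on the sphere of radius `r`
centered at the origin of the Euclidean space `ℝ^ι`. -/
noncomputable def sphereUniform (ι : Type*) [Fintype ι] (r : ℝ) :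
    Measure (EuclideanSpace ℝ ι) :=
  (μH[(Fintype.card ι : ℝ) - 1] (Metric.sphere (0 : EuclideanSpace ℝ ι) r))⁻¹ •
    (μH[(Fintype.card ι : ℝ) - 1]).restrict (Metric.sphere (0 : EuclideanSpace ℝ ι) r)

/-- The fundamental domain `[0,1)^n` of the torus `𝕋^n = ℝ^n/ℤ^n`; since the integrands
below are `ℤ^n`-periodic, integration over it with respect to Lebesgue measure is
integration over the torus with respect to normalized volume. -/
def unitCube (n : ℕ) : Set (Fin n → ℝ) :=
  Set.univ.pi fun _ : Fin n => Set.Ico (0:ℝ) 1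

/-- The random eigenfunction `f(x) = Re(Σ_{v ∈ V} a_v e^{2πi⟨Bv, x⟩})`. -/
noncomputable def torusEigen {n : ℕ} (B : Matrix (Fin n) (Fin n) ℝ)
    (V : Finset (Fin n → ℝ)) (a : EuclideanSpace ℝ V) (x : Fin n → ℝ) : ℝ :=
  (∑ v : V, (a v : ℂ)
      * Complex.exp (2 * Real.pi * Complex.I * (((B.mulVec v.val) ⬝ᵥ x : ℝ) : ℂ))).re

/-- The `B`-gradient `∇_B f(x) = −Im(Σ_{v ∈ V} 2π a_v e^{2πi⟨Bv, x⟩} v)` of the random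
eigenfunction. -/
noncomputable def torusGradB {n : ℕ} (B : Matrix (Fin n) (Fin n) ℝ)
    (V : Finset (Fin n → ℝ)) (a : EuclideanSpace ℝ V) (x : Fin n → ℝ) : Fin n → ℝ :=
  fun ℓ => -(∑ v : V, ((2 * Real.pi * a v : ℝ) : ℂ)
      * Complex.exp (2 * Real.pi * Complex.I * (((B.mulVec v.val) ⬝ᵥ x : ℝ) : ℂ))
      * ((v.val ℓ : ℝ) : ℂ)).im

section
variable {E : Type*} [NormedAddCommGroup E] [InnerProductSpace ℝ E] [FiniteDimensional ℝ E]
  [MeasurableSpace E] [BorelSpace E]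

theorem Continuous.integrable_of_ae_norm_eq {μ : Measure E} [IsFiniteMeasure μ] {r : ℝ}
    (hr : ∀ᵐ a ∂μ, ‖a‖ = r) {f : E → ℝ} (hf : Continuous f) : Integrable f μ := by
  have h : ∀ᵐ a ∂μ, a ∈ Metric.sphere (0 : E) r := by simpa using hr
  rw [← Measure.restrict_eq_self_of_ae_mem h]
  exact hf.continuousOn.integrableOn_compact (isCompact_sphere 0 r)

theorem integral_inner_pow_four_eq {μ : Measure E}
    (hμ : ∀ φ : E ≃ₗᵢ[ℝ] E, μ.map φ = μ) (e u : E) (he : ‖e‖ = 1) :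
    ∫ a, inner ℝ u a ^ 4 ∂μ = inner ℝ u u ^ 2 * ∫ a, inner ℝ e a ^ 4 ∂μ := by
  have hn : ‖u‖ = ‖‖u‖ • e‖ := by simp [norm_smul, he]
  let φ := (ℝ ∙ (u - ‖u‖ • e))ᗮ.reflection
  have h1 : φ u = ‖u‖ • e := Submodule.reflection_sub hn
  calc ∫ a, inner ℝ u a ^ 4 ∂μ = ∫ a, inner ℝ (φ u) (φ a) ^ 4 ∂μ := by
        simp only [LinearIsometryEquiv.inner_map_map]
    _ = ∫ a, inner ℝ (φ u) a ^ 4 ∂(μ.map φ) := by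
        rw [integral_map φ.continuous.aemeasurable (by fun_prop)]
    _ = _ := by
        rw [hμ, h1, ← integral_const_mul, real_inner_self_eq_norm_sq]
        congr 1 with a
        rw [inner_smul_left]
        simp
        ring

theorem integral_inner_mul_four_eq {μ : Measure E} [IsFiniteMeasure μ] {r : ℝ}
    (hr : ∀ᵐ a ∂μ, ‖a‖ = r) (hμ : ∀ φ : E ≃ₗᵢ[ℝ] E, μ.map φ = μ)
    (e x y z w : E) (he : ‖e‖ = 1) :
    ∫ a, inner ℝ x a * inner ℝ y a * inner ℝ z a * inner ℝ w a ∂μ =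
      (inner ℝ x y * inner ℝ z w + inner ℝ x z * inner ℝ y w + inner ℝ x w * inner ℝ y z) *
        ((∫ a, inner ℝ e a ^ 4 ∂μ) / 3) := by
  have h4 := fun u ↦ integral_inner_pow_four_eq hμ e u he
  generalize ∫ a, inner ℝ e a ^ 4 ∂μ = c at h4 ⊢
  let S : Finset ℝ := {1, -1}
  have hsum (f : ℝ → ℝ) : ∑ s ∈ S, f s = f 1 + f (-1) := Finset.sum_pair (by norm_num)
  have hpol (a : E) : inner ℝ x a * inner ℝ y a * inner ℝ z a * inner ℝ w a =
      ∑ p ∈ S, ∑ q ∈ S, ∑ s ∈ S,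
        p * q * s / 192 * inner ℝ (x + p • y + q • z + s • w) a ^ 4 := by
    simp only [hsum, inner_add_left, inner_smul_left, conj_trivial]
    ring
  have hint (c : ℝ) (u : E) : Integrable (fun a ↦ c * inner ℝ u a ^ 4) μ :=
    Continuous.integrable_of_ae_norm_eq hr (by fun_prop)
  simp_rw [hpol]
  rw [integral_finsetSum _ fun p _ ↦ integrable_finsetSum _ fun q _ ↦
    integrable_finsetSum _ fun s _ ↦ hint _ _]
  simp_rw [integral_finsetSum S fun q _ ↦ integrable_finsetSum S fun s _ ↦ hint _ _,
    integral_finsetSum S fun s _ ↦ hint _ _, integral_const_mul,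
    h4, hsum, inner_add_left, inner_add_right, inner_smul_left,
    inner_smul_right, conj_trivial, real_inner_comm x y, real_inner_comm x z, real_inner_comm x w,
    real_inner_comm y z, real_inner_comm y w, real_inner_comm z w]
  ring

end

theorem integral_sq_quadratic_of_rotation_invariant {ι : Type*} [Fintype ι] [Nonempty ι]
    {μ : Measure (EuclideanSpace ℝ ι)} [IsProbabilityMeasure μ] {r : ℝ}
    (hr : ∀ᵐ a ∂μ, ‖a‖ = r)
    (hμ : ∀ φ : EuclideanSpace ℝ ι ≃ₗᵢ[ℝ] EuclideanSpace ℝ ι, μ.map φ = μ)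
    (M : ι → ι → ℝ) (hM : ∀ i j, M i j = M j i) :
    ∫ a, (∑ i, ∑ j, a i * a j * M i j) ^ 2 ∂μ =
      r ^ 4 / (Fintype.card ι * (Fintype.card ι + 2)) *
        ((∑ i, M i i) ^ 2 + 2 * ∑ i, ∑ j, M i j ^ 2) := by
  classical
  obtain ⟨i₀⟩ := ‹Nonempty ι›
  set c := (∫ a, inner ℝ (EuclideanSpace.single i₀ (1 : ℝ)) a ^ 4 ∂μ) / 3 with hc
  have hmom (i j k l : ι) : ∫ a, a i * a j * a k * a l ∂μ =
      ((if i = j then 1 else 0) * (if k = l then 1 else 0) +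
        (if i = k then 1 else 0) * (if j = l then 1 else 0) +
        (if i = l then 1 else 0) * (if j = k then 1 else 0)) * c := by
    have := integral_inner_mul_four_eq hr hμ (EuclideanSpace.single i₀ (1 : ℝ))
      (EuclideanSpace.single i 1) (EuclideanSpace.single j 1) (EuclideanSpace.single k 1)
      (EuclideanSpace.single l 1) (by simp)
    simpa [EuclideanSpace.inner_single_left, PiLp.single_apply, hc] using this
  have key (M : ι → ι → ℝ) (hM : ∀ i j, M i j = M j i) :
      ∫ a, (∑ i, ∑ j, a i * a j * M i j) ^ 2 ∂μ =
        ((∑ i, M i i) ^ 2 + 2 * ∑ i, ∑ j, M i j ^ 2) * c := by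
    have hexp (a : EuclideanSpace ℝ ι) : (∑ i, ∑ j, a i * a j * M i j) ^ 2 =
        ∑ i, ∑ j, ∑ k, ∑ l, M i j * M k l * (a i * a j * a k * a l) := by
      simp_rw [sq, Finset.sum_mul, Finset.mul_sum]
      refine Finset.sum_congr rfl fun i _ ↦ Finset.sum_congr rfl fun j _ ↦
        Finset.sum_congr rfl fun k _ ↦ Finset.sum_congr rfl fun l _ ↦ by ring
    have hint {f : EuclideanSpace ℝ ι → ℝ} (hf : Continuous f) : Integrable f μ :=
      Continuous.integrable_of_ae_norm_eq hr hf
    calc _ = ∑ i, ∑ j, ∑ k, ∑ l, M i j * M k l * ∫ a, a i * a j * a k * a l ∂μ := by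
          simp_rw [hexp]
          rw [integral_finsetSum _ fun i _ ↦ hint (by fun_prop)]
          refine Finset.sum_congr rfl fun i _ ↦ ?_
          rw [integral_finsetSum _ fun i _ ↦ hint (by fun_prop)]
          refine Finset.sum_congr rfl fun j _ ↦ ?_
          rw [integral_finsetSum _ fun i _ ↦ hint (by fun_prop)]
          refine Finset.sum_congr rfl fun k _ ↦ ?_
          rw [integral_finsetSum _ fun i _ ↦ hint (by fun_prop)]
          refine Finset.sum_congr rfl fun l _ ↦ ?_
          rw [integral_const_mul]
      _ = _ := by
          simp_rw [hmom, ← mul_assoc, ← Finset.sum_mul]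
          congr 1
          simp only [mul_add, Finset.sum_add_distrib, ← mul_assoc]
          simp
          simp_rw [fun i j ↦ hM j i, ← sq, two_mul, ← Finset.mul_sum, ← Finset.sum_mul,
            ← add_assoc, ← sq]
  have hone : r ^ 4 = (Fintype.card ι * (Fintype.card ι + 2)) * c := by
    have h := key (fun i j ↦ if i = j then 1 else 0) (fun i j ↦ by simp [eq_comm])
    have h2 : ∀ᵐ a ∂μ, (∑ i, ∑ j, a i * a j * if i = j then (1 : ℝ) else 0) ^ 2 = r ^ 4 := by
      filter_upwards [hr] with a ha
      rw [← ha, show ‖a‖ ^ 4 = (‖a‖ ^ 2) ^ 2 by ring, EuclideanSpace.real_norm_sq_eq]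
      simp [sq]
    rw [integral_congr_ae h2] at h
    simp at h
    rw [h]; ring
  have hN : (0 : ℝ) < Fintype.card ι := by
    exact_mod_cast Fintype.card_pos_iff.mpr ⟨i₀⟩
  rw [key M hM, hone]
  field_simp

theorem map_sphereUniform {ι : Type*} [Fintype ι] (r : ℝ)
    (φ : EuclideanSpace ℝ ι ≃ₗᵢ[ℝ] EuclideanSpace ℝ ι) :
    (sphereUniform ι r).map φ = sphereUniform ι r := by
  have h := (φ.toIsometryEquiv.measurePreserving_hausdorffMeasure
    ((Fintype.card ι : ℝ) - 1)).restrict_preimage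
    (Metric.isClosed_sphere (x := (0 : EuclideanSpace ℝ ι)) (ε := r)).measurableSet
  have hpre : φ.toIsometryEquiv ⁻¹' Metric.sphere 0 r = Metric.sphere 0 r := by
    ext; simp
  rw [hpre] at h
  rw [sphereUniform, Measure.map_smul]
  congr 1
  exact h.map_eq

theorem ae_norm_eq_sphereUniform {ι : Type*} [Fintype ι] (r : ℝ) :
    ∀ᵐ a ∂sphereUniform ι r, ‖a‖ = r := by
  refine Measure.ae_smul_measure ?_ _
  filter_upwards [ae_restrict_mem Metric.isClosed_sphere.measurableSet] with a ha
  simpa using ha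

theorem volume_restrict_unitCube (n : ℕ) :
    (volume : Measure (Fin n → ℝ)).restrict (unitCube n) =
      Measure.pi fun _ ↦ volume.restrict (Set.Ico (0 : ℝ) 1) := by
  rw [unitCube, volume_pi, Measure.restrict_pi_pi]

instance isProbabilityMeasure_restrict_unitCube (n : ℕ) :
    IsProbabilityMeasure (volume.restrict (unitCube n)) := by
  have : IsProbabilityMeasure (volume.restrict (Set.Ico (0 : ℝ) 1)) := ⟨by simp⟩
  rw [volume_restrict_unitCube]
  infer_instance

theorem integral_exp_int_mul_Ico (k : ℤ) :
    ∫ t in Set.Ico (0 : ℝ) 1, Complex.exp (2 * π * Complex.I * k * t) =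
      if k = 0 then 1 else 0 := by
  split_ifs with hk
  · simp [hk]
  · have hc : 2 * π * Complex.I * k ≠ 0 := by simp [hk, Complex.I_ne_zero, pi_ne_zero]
    rw [integral_Ico_eq_integral_Ioc, ← intervalIntegral.integral_of_le zero_le_one,
      integral_exp_mul_complex hc]
    have : Complex.exp (2 * π * Complex.I * k) = 1 := by
      rw [mul_comm, Complex.exp_int_mul_two_pi_mul_I]
    simp [this]

theorem integral_cos_unitCube {n : ℕ} (k : Fin n → ℝ) (hk : ∀ j, ∃ z : ℤ, k j = z) (hk0 : k ≠ 0) :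
    ∫ x in unitCube n, cos (2 * π * (k ⬝ᵥ x)) = 0 := by
  choose z hz using hk
  have hexp : ∫ x in unitCube n, Complex.exp (2 * π * Complex.I * ((k ⬝ᵥ x : ℝ) : ℂ)) = 0 := by
    have hprod (x : Fin n → ℝ) : Complex.exp (2 * π * Complex.I * ((k ⬝ᵥ x : ℝ) : ℂ)) =
        ∏ j, Complex.exp (2 * π * Complex.I * z j * x j) := by
      rw [← Complex.exp_sum]
      simp [dotProduct, hz, Finset.mul_sum, mul_assoc]
    simp_rw [hprod]
    rw [volume_restrict_unitCube,
      integral_fintype_prod_eq_prod fun j (t : ℝ) ↦ Complex.exp (2 * π * Complex.I * z j * t)]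
    obtain ⟨j, hj⟩ := Function.ne_iff.mp hk0
    refine Finset.prod_eq_zero (Finset.mem_univ j) ?_
    have : z j ≠ 0 := by rintro h; simp [hz, h] at hj
    simp [integral_exp_int_mul_Ico, this]
  have hphase (x : Fin n → ℝ) : 2 * π * Complex.I * ((k ⬝ᵥ x : ℝ) : ℂ) =
      ((2 * π * (k ⬝ᵥ x) : ℝ) : ℂ) * Complex.I := by
    push_cast; ring
  have hre (x : Fin n → ℝ) : cos (2 * π * (k ⬝ᵥ x)) =
      RCLike.re (Complex.exp (2 * π * Complex.I * ((k ⬝ᵥ x : ℝ) : ℂ))) := by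
    rw [hphase]
    exact (Complex.exp_ofReal_mul_I_re _).symm
  simp_rw [hre]
  rw [integral_re, hexp]
  · simp
  · refine Integrable.of_bound (C := 1) (Continuous.aestronglyMeasurable ?_)
      (.of_forall fun x ↦ ?_)
    · unfold dotProduct; fun_prop
    · rw [hphase, Complex.norm_exp_ofReal_mul_I]

theorem integrable_unitCube {n : ℕ} {f : (Fin n → ℝ) → ℝ} (hf : Continuous f) :
    Integrable f (volume.restrict (unitCube n)) := by
  refine (hf.continuousOn.integrableOn_compact
    (isCompact_univ_pi fun _ : Fin n ↦ isCompact_Icc (a := (0 : ℝ)) (b := 1))).mono_set ?_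
  exact Set.pi_mono fun _ _ ↦ Set.Ico_subset_Icc_self

theorem integral_sin_sq_mul_sin_sq_unitCube {n : ℕ} (k l : Fin n → ℝ)
    (hk : ∀ j, ∃ z : ℤ, k j = z) (hl : ∀ j, ∃ z : ℤ, l j = z)
    (hk0 : k ≠ 0) (hl0 : l ≠ 0) (hadd : k + l ≠ 0) :
    ∫ x in unitCube n, sin (2 * π * (k ⬝ᵥ x)) ^ 2 * sin (2 * π * (l ⬝ᵥ x)) ^ 2 =
      1 / 4 + if k = l then 1 / 8 else 0 := by
  have hexp (x : Fin n → ℝ) :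
      sin (2 * π * (k ⬝ᵥ x)) ^ 2 * sin (2 * π * (l ⬝ᵥ x)) ^ 2 =
        1 / 4 - 1 / 4 * cos (2 * π * ((k + k) ⬝ᵥ x)) - 1 / 4 * cos (2 * π * ((l + l) ⬝ᵥ x)) +
          1 / 8 * cos (2 * π * ((k + l + (k + l)) ⬝ᵥ x)) +
          1 / 8 * cos (2 * π * ((k - l + (k - l)) ⬝ᵥ x)) := by
    simp only [add_dotProduct, sub_dotProduct, sin_sq_eq_half_sub]
    generalize k ⬝ᵥ x = s
    generalize l ⬝ᵥ x = t
    rw [show 2 * π * (s + t + (s + t)) = 2 * (2 * π * s) + 2 * (2 * π * t) by ring,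
      show 2 * π * (s - t + (s - t)) = 2 * (2 * π * s) - 2 * (2 * π * t) by ring,
      show 2 * π * (s + s) = 2 * (2 * π * s) by ring,
      show 2 * π * (t + t) = 2 * (2 * π * t) by ring, cos_add, cos_sub]
    ring
  have hself {m : Fin n → ℝ} (hm : m ≠ 0) : m + m ≠ 0 := by
    rw [← two_smul ℝ m]; exact smul_ne_zero two_ne_zero hm
  have hZ {p q : Fin n → ℝ} (hp : ∀ j, ∃ z : ℤ, p j = z) (hq : ∀ j, ∃ z : ℤ, q j = z) (j : Fin n) :
      ∃ z : ℤ, (p + q) j = z := by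
    obtain ⟨⟨y, hy⟩, ⟨z, hz⟩⟩ := And.intro (hp j) (hq j)
    exact ⟨y + z, by simp [hy, hz]⟩
  have hZ' (j : Fin n) : ∃ z : ℤ, (k - l) j = z := by
    obtain ⟨⟨y, hy⟩, ⟨z, hz⟩⟩ := And.intro (hk j) (hl j)
    exact ⟨y - z, by simp [hy, hz]⟩
  simp_rw [hexp]
  rw [integral_add, integral_add, integral_sub, integral_sub]
  · simp_rw [integral_const_mul]
    rw [integral_cos_unitCube _ (hZ hk hk) (hself hk0),
      integral_cos_unitCube _ (hZ hl hl) (hself hl0),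
      integral_cos_unitCube _ (hZ (hZ hk hl) (hZ hk hl)) (hself hadd)]
    split_ifs with h
    · simp [h]
    · rw [integral_cos_unitCube _ (hZ hZ' hZ') (hself (sub_ne_zero.mpr h))]
      simp
  all_goals exact integrable_unitCube (by (try unfold dotProduct); fun_prop)

theorem bInner_comm {n : ℕ} {B : Matrix (Fin n) (Fin n) ℝ} (hB : B.IsHermitian)
    (x y : Fin n → ℝ) : bInner B x y = bInner B y x := by
  have hT : Bᵀ = B := by simpa using hB.eq
  rw [bInner, bInner, dotProduct_comm, dotProduct_mulVec, ← mulVec_transpose, hT]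

theorem torusGradB_eq_sum {n : ℕ} (B : Matrix (Fin n) (Fin n) ℝ) (V : Finset (Fin n → ℝ))
    (a : EuclideanSpace ℝ V) (x : Fin n → ℝ) :
    torusGradB B V a x =
      ∑ v : V, (-(2 * π) * (a v * sin (2 * π * (B.mulVec v.val ⬝ᵥ x)))) • v.val := by
  ext ℓ
  have h (t : ℝ) : 2 * π * Complex.I * (t : ℂ) = ((2 * π * t : ℝ) : ℂ) * Complex.I := by
    push_cast; ring
  simp only [torusGradB, h, Complex.im_sum, Complex.im_mul_ofReal, Complex.im_ofReal_mul,
    Complex.exp_ofReal_mul_I_im, Finset.sum_apply, Pi.smul_apply, smul_eq_mul,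
    ← Finset.sum_neg_distrib]
  exact Finset.sum_congr rfl fun v _ ↦ by ring

theorem bInner_torusGradB_self {n : ℕ} (B : Matrix (Fin n) (Fin n) ℝ) (V : Finset (Fin n → ℝ))
    (a : EuclideanSpace ℝ V) (x : Fin n → ℝ) :
    bInner B (torusGradB B V a x) (torusGradB B V a x) =
      ∑ v : V, ∑ w : V, a v * a w * (4 * π ^ 2 * (sin (2 * π * (B.mulVec v.val ⬝ᵥ x)) *
        sin (2 * π * (B.mulVec w.val ⬝ᵥ x)) * bInner B v.val w.val)) := by
  simp only [torusGradB_eq_sum, bInner, mulVec_sum, mulVec_smul, sum_dotProduct, dotProduct_sum,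
    smul_dotProduct, dotProduct_smul, smul_eq_mul, Finset.mul_sum]
  rw [Finset.sum_comm]
  exact Finset.sum_congr rfl fun v _ ↦ Finset.sum_congr rfl fun w _ ↦ by ring

theorem integral_sq_bInner_torusGradB {n : ℕ} {B : Matrix (Fin n) (Fin n) ℝ} (hB : B.IsHermitian)
    (V : Finset (Fin n → ℝ)) (hne : V.Nonempty)
    [IsProbabilityMeasure (sphereUniform V (√2))] (x : Fin n → ℝ) :
    ∫ a, bInner B (torusGradB B V a x) (torusGradB B V a x) ^ 2 ∂sphereUniform V (√2) =
      64 * π ^ 4 / (V.card * (V.card + 2)) * ∑ v : V, ∑ w : V,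
        (bInner B v.val v.val * bInner B w.val w.val + 2 * bInner B v.val w.val ^ 2) *
        (sin (2 * π * (B.mulVec v.val ⬝ᵥ x)) ^ 2 * sin (2 * π * (B.mulVec w.val ⬝ᵥ x)) ^ 2) := by
  have : Nonempty V := hne.to_subtype
  simp_rw [bInner_torusGradB_self]
  rw [integral_sq_quadratic_of_rotation_invariant (ae_norm_eq_sphereUniform _)
    (map_sphereUniform _) _ fun v w ↦ by rw [bInner_comm hB]; ring, Fintype.card_coe,
    show √2 ^ 4 = 4 by rw [show √2 ^ 4 = (√2 ^ 2) ^ 2 by ring, sq_sqrt zero_le_two]; norm_num,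
    sq, Finset.sum_mul_sum, Finset.mul_sum, ← Finset.sum_add_distrib, Finset.mul_sum,
    Finset.mul_sum]
  refine Finset.sum_congr rfl fun v _ ↦ ?_
  rw [Finset.mul_sum, ← Finset.sum_add_distrib, Finset.mul_sum, Finset.mul_sum]
  exact Finset.sum_congr rfl fun w _ ↦ by ring

/-- Fourth moment of the `B`-norm of the gradient of a random
eigenfunction on the torus:
`E_X E_a[‖∇_B f_r(X)‖_B⁴] = (8π⁴/(|𝒱|(|𝒱|+2))) [3 Σ_v ‖v‖_B⁴ + 2 (Σ_v ‖v‖_B²)²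
  + 4 Σ_{v,w} ⟨v,w⟩_B²]`. -/
theorem torus_gradient_fourth_moment
    {n : ℕ} (B : Matrix (Fin n) (Fin n) ℝ) (hB : B.PosDef)
    (V : Finset (Fin n → ℝ)) (hne : V.Nonempty)
    (hint : ∀ v ∈ V, ∀ ℓ, ∃ z : ℤ, B.mulVec v ℓ = (z : ℝ))
    (hnocancel : ∀ v ∈ V, ∀ w ∈ V, v + w ≠ 0)
    {Ω : Type} [MeasurableSpace Ω] (P : Measure Ω) [IsProbabilityMeasure P]
    (a : Ω → EuclideanSpace ℝ V) (hameas : Measurable a)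
    (halaw : Measure.map a P = sphereUniform V (Real.sqrt 2)) :
    ∫ x in unitCube n,
        (∫ ω, (bInner B (torusGradB B V (a ω) x) (torusGradB B V (a ω) x)) ^ 2 ∂P) ∂volume
      = 8 * Real.pi ^ 4 / ((V.card : ℝ) * ((V.card : ℝ) + 2))
          * (3 * (∑ v ∈ V, (bInner B v v) ^ 2)
              + 2 * (∑ v ∈ V, bInner B v v) ^ 2
              + 4 * ∑ v ∈ V, ∑ w ∈ V, (bInner B v w) ^ 2) := by
  have : IsProbabilityMeasure (sphereUniform V (√2)) :=
    halaw ▸ Measure.isProbabilityMeasure_map hameas.aemeasurable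
  have hE (x : Fin n → ℝ) :
      ∫ ω, bInner B (torusGradB B V (a ω) x) (torusGradB B V (a ω) x) ^ 2 ∂P =
        ∫ b, bInner B (torusGradB B V b x) (torusGradB B V b x) ^ 2 ∂sphereUniform V (√2) := by
    rw [← halaw, integral_map hameas.aemeasurable]
    simp_rw [bInner_torusGradB_self]
    exact Continuous.aestronglyMeasurable (by fun_prop)
  have hinj : Function.Injective B.mulVec := mulVec_injective_of_isUnit hB.isUnit
  have hne0 {u : Fin n → ℝ} (hu : u ≠ 0) : B.mulVec u ≠ 0 := fun h ↦
    hu (hinj (h.trans (mulVec_zero B).symm))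
  have hV0 (v : V) : B.mulVec v.val ≠ 0 := hne0 fun h ↦ hnocancel v v.2 v v.2 (by simp [h])
  have hX (v w : V) : ∫ x in unitCube n, sin (2 * π * (B.mulVec v.val ⬝ᵥ x)) ^ 2 *
      sin (2 * π * (B.mulVec w.val ⬝ᵥ x)) ^ 2 = 1 / 4 + if v = w then 1 / 8 else 0 := by
    rw [integral_sin_sq_mul_sin_sq_unitCube _ _ (hint v v.2) (hint w w.2) (hV0 v) (hV0 w)
      (mulVec_add B v.val w.val ▸ hne0 (hnocancel v v.2 w w.2))]
    simp only [hinj.eq_iff, Subtype.ext_iff]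
  have hI (c : ℝ) (v w : V) : Integrable (fun x ↦ c * (sin (2 * π * (B.mulVec v.val ⬝ᵥ x)) ^ 2 *
      sin (2 * π * (B.mulVec w.val ⬝ᵥ x)) ^ 2)) (volume.restrict (unitCube n)) :=
    integrable_unitCube (by unfold dotProduct; fun_prop)
  simp_rw [hE, integral_sq_bInner_torusGradB hB.isHermitian V hne]
  rw [integral_const_mul,
    integral_finsetSum _ fun v _ ↦ integrable_finsetSum _ fun w _ ↦ hI _ v w]
  simp_rw [integral_finsetSum Finset.univ fun w _ ↦ hI _ _ w, integral_const_mul, hX,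
    ← Finset.sum_coe_sort V]
  simp only [mul_add, mul_ite, mul_zero, Finset.sum_add_distrib, Finset.sum_ite_eq,
    Finset.mem_univ, if_true, add_mul, ← Finset.sum_mul, ← Finset.mul_sum]
  simp only [← sq]
  ring
end
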